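/- Let α be a zero-sum-free sequence of length n over an abelian group, and suppose that the set Σ(α) of all subsequence sums of α has at most m elements, where m < 2n. Then some group element appears in α with multiplicity at least n − (m−1)/3; equivalently, the maximum multiplicity μ of a term of α satisfies 3μ ≥ 3n − (m − 1). -/

import Mathlib

/-- The set of all subsequence sums of a list (including the sum 0 of the empty
subsequence). -/
def subSums {G : Type*} [AddCommMonoid G] [DecidableEq G] (l : List G) : Finset G :=
  (l.sublists.map List.sum).toFinset

/-- A sequence is zero-sum-free if no nonempty subsequence sums to zero. -/
def ZeroSumFree {G : Type*} [AddCommMonoid G] (l : List G) : Prop :=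
  ∀ t : List G, t.Sublist l → t ≠ [] → t.sum ≠ 0

section ZeroSumFree

open Finset

variable {G : Type*} [AddCommGroup G]

theorem ZeroSumFree.perm {l l' : List G} (hl : ZeroSumFree l) (h : l.Perm l') :
    ZeroSumFree l' := by
  intro t ht hne
  obtain ⟨t', htt', ht'⟩ := ht.subperm.trans h.symm.subperm
  rw [← htt'.sum_eq]
  refine hl t' ht' ?_
  rintro rfl
  exact hne (List.nil_perm.1 htt')

variable [DecidableEq G]

theorem mem_subSums {l : List G} {x : G} :
    x ∈ subSums l ↔ ∃ t : List G, t.Sublist l ∧ t.sum = x := by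
  simp [subSums]

theorem zero_mem_subSums (l : List G) : (0 : G) ∈ subSums l :=
  mem_subSums.2 ⟨[], by simp, by simp⟩

theorem sum_mem_subSums (l : List G) : l.sum ∈ subSums l :=
  mem_subSums.2 ⟨l, List.Sublist.refl l, rfl⟩

theorem subSums_cons (a : G) (l : List G) :
    subSums (a :: l) = subSums l ∪ (subSums l).image (a + ·) := by
  ext x
  simp only [mem_union, mem_image, mem_subSums, List.sublist_cons_iff]
  constructor
  · rintro ⟨t, h | ⟨r, rfl, h⟩, rfl⟩
    · exact Or.inl ⟨t, h, rfl⟩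
    · exact Or.inr ⟨r.sum, ⟨r, h, rfl⟩, by simp⟩
  · rintro (⟨t, h, rfl⟩ | ⟨_, ⟨t, h, rfl⟩, rfl⟩)
    · exact ⟨t, Or.inl h, rfl⟩
    · exact ⟨a :: t, Or.inr ⟨t, rfl, h⟩, by simp⟩

theorem subSums_subset_of_perm {l l' : List G} (h : l.Perm l') : subSums l ⊆ subSums l' := by
  intro x hx
  obtain ⟨t, ht, rfl⟩ := mem_subSums.1 hx
  obtain ⟨t', htt', ht'⟩ := ht.subperm.trans h.subperm
  exact mem_subSums.2 ⟨t', ht', htt'.sum_eq⟩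

theorem subSums_eq_of_perm {l l' : List G} (h : l.Perm l') : subSums l = subSums l' :=
  (subSums_subset_of_perm h).antisymm (subSums_subset_of_perm h.symm)

theorem ZeroSumFree.add_ne_zero {a : G} {l : List G} (h : ZeroSumFree (a :: l)) {x : G}
    (hx : x ∈ subSums l) : a + x ≠ 0 := by
  obtain ⟨t, ht, rfl⟩ := mem_subSums.1 hx
  simpa using h (a :: t) (ht.cons_cons a) (by simp)

/-- The total sum of a zero-sum-free sequence is not attained once a term is removed. -/
theorem ZeroSumFree.add_sum_notMem {a : G} {l : List G} (h : ZeroSumFree (a :: l)) :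
    a + l.sum ∉ subSums l := by
  intro hx
  obtain ⟨t, ht, hs⟩ := mem_subSums.1 hx
  obtain ⟨r, hr⟩ := ht.exists_perm_append
  have hrs : a + r.sum = 0 := by
    have h1 := hr.sum_eq
    rw [List.sum_append, hs] at h1
    have : l.sum + (a + r.sum) = l.sum + 0 := by
      rw [add_zero]; nth_rewrite 2 [h1]; abel
    exact add_left_cancel this
  refine h.add_ne_zero (mem_subSums.2 ?_) hrs
  obtain ⟨r', hr', hsub⟩ : r.Subperm l :=
    (List.sublist_append_right t r).subperm.trans hr.symm.subperm
  exact ⟨r', hsub, hr'.sum_eq⟩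

/-- If removing any term of a zero-sum-free sequence loses only one subsequence sum, then all
terms are equal. -/
theorem ZeroSumFree.eq_of_card_subSums_le {l : List G} (hl : ZeroSumFree l)
    (h : ∀ a ∈ l, (subSums l).card ≤ (subSums (l.erase a)).card + 1)
    {a b : G} (ha : a ∈ l) (hb : b ∈ l) : a = b := by
  have key : ∀ c ∈ l, subSums (l.erase c) = (subSums l).erase l.sum ∧
      ((subSums l).erase l.sum).image (c + ·) = (subSums l).erase 0 := by
    intro c hc
    have hp := List.perm_cons_erase hc
    have hz := hl.perm hp
    have hS := subSums_eq_of_perm hp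
    rw [subSums_cons] at hS
    have hsum := hp.sum_eq
    rw [List.sum_cons] at hsum
    have h1 : subSums (l.erase c) = (subSums l).erase l.sum := by
      refine eq_of_subset_of_card_le (fun x hx => mem_erase.2 ⟨?_, ?_⟩) ?_
      · rintro rfl
        rw [hsum] at hx
        exact hz.add_sum_notMem hx
      · rw [hS]; exact mem_union_left _ hx
      · rw [card_erase_of_mem (sum_mem_subSums l)]
        have := h c hc
        omega
    refine ⟨h1, eq_of_subset_of_card_le (fun x hx => mem_erase.2 ⟨?_, ?_⟩) ?_⟩
    · rw [← h1] at hx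
      obtain ⟨y, hy, rfl⟩ := mem_image.1 hx
      exact hz.add_ne_zero hy
    · rw [hS, h1]; exact mem_union_right _ hx
    · rw [card_image_of_injective _ (add_right_injective c),
        card_erase_of_mem (sum_mem_subSums l), card_erase_of_mem (zero_mem_subSums l)]
  by_contra hab
  have hT := (key a ha).2.trans (key b hb).2.symm
  have hmem : ∀ x ∈ (subSums l).erase l.sum, x + (a - b) ∈ (subSums l).erase l.sum := by
    intro x hx
    have : a + x ∈ ((subSums l).erase l.sum).image (b + ·) := hT ▸ mem_image_of_mem _ hx
    obtain ⟨y, hy, hxy⟩ := mem_image.1 this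
    have : x + (a - b) = y := by
      have hxy : b + y = a + x := hxy
      rw [eq_comm, ← add_right_inj b, hxy]; abel
    rwa [this]
  have h0 : (0 : G) ∈ (subSums l).erase l.sum := by
    rw [← (key a ha).1]; exact zero_mem_subSums _
  have hd := hmem 0 h0
  rw [zero_add] at hd
  have hd' : a - b ∈ ((subSums l).erase l.sum).image (a + ·) := by
    rw [(key a ha).2]
    exact mem_erase.2 ⟨sub_ne_zero.2 hab, (mem_erase.1 hd).2⟩
  obtain ⟨y, hy, hy'⟩ := mem_image.1 hd'
  have hy' : a + y = a - b := hy'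
  have hb0 : (0 : G) ∈ ((subSums l).erase l.sum).image (b + ·) :=
    mem_image.2 ⟨y, hy, by
      have : y = -b := by rw [← add_right_inj a, hy']; abel
      simp [this]⟩
  rw [(key b hb).2] at hb0
  exact (mem_erase.1 hb0).1 rfl

theorem subSums_replicate (n : ℕ) (g : G) :
    subSums (List.replicate n g) = (range (n + 1)).image (· • g) := by
  ext x
  simp only [mem_subSums, mem_image, mem_range, List.sublist_replicate_iff]
  constructor
  · rintro ⟨t, ⟨k, hk, rfl⟩, rfl⟩
    exact ⟨k, by omega, by simp⟩
  · rintro ⟨k, hk, rfl⟩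
    exact ⟨List.replicate k g, ⟨k, by omega, rfl⟩, by simp⟩

theorem card_image_nsmul_range {g : G} {s : ℕ} (h : ∀ k, 0 < k → k ≤ s → k • g ≠ 0) :
    ((range (s + 1)).image (· • g)).card = s + 1 := by
  rw [card_image_of_injOn, card_range]
  have key : ∀ i j : ℕ, i ≤ j → j ≤ s → i • g = j • g → i = j := by
    intro i j hij hj he
    by_contra hne
    refine h (j - i) (by omega) (by omega) ?_
    obtain ⟨k, rfl⟩ := Nat.exists_eq_add_of_le hij
    rw [add_nsmul, left_eq_add] at he
    simpa using he
  intro i hi j hj he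
  have hi := mem_range.1 hi
  have hj := mem_range.1 hj
  rcases le_total i j with hij | hij
  · exact key i j hij (by omega) he
  · exact (key j i hij (by omega) he.symm).symm

/-- A zero-sum-free sequence with fewer than `2n` subsequence sums consists of positive
multiples of a single element, and its subsequence sums form an arithmetic progression. -/
theorem ZeroSumFree.exists_perm_map_nsmul {l : List G} (hl : ZeroSumFree l)
    (hc : (subSums l).card < 2 * l.length) :
    ∃ (g : G) (L : List ℕ), l.Perm (L.map (· • g)) ∧ (∀ x ∈ L, 0 < x) ∧
      subSums l = (range (L.sum + 1)).image (· • g) ∧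
      ∀ k, 0 < k → k ≤ L.sum → k • g ≠ 0 := by
  induction hn : l.length generalizing l with
  | zero => simp [hn] at hc
  | succ n ih =>
  by_cases hex : ∃ a ∈ l, (subSums (l.erase a)).card < 2 * n
  · obtain ⟨a, ha, hcard⟩ := hex
    have hp := List.perm_cons_erase ha
    have hz := hl.perm hp
    have hlen : (l.erase a).length = n := by
      rw [List.length_erase_of_mem ha, hn]; rfl
    obtain ⟨g, L, hL, hpos, hS, hne⟩ := ih
      (fun t ht => hz t (ht.cons a)) (by rwa [hlen]) hlen
    have hLlen : n = L.length := by rw [← hlen, hL.length_eq, List.length_map]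
    have hLs := List.length_le_sum_of_one_le L hpos
    have hSl := subSums_eq_of_perm hp
    rw [subSums_cons] at hSl
    have hmem : ∀ k, k ≤ L.sum → k • g ∈ subSums (l.erase a) := fun k hk => by
      rw [hS]; exact mem_image_of_mem _ (mem_range.2 (by omega))
    have hnd : ¬ Disjoint (subSums (l.erase a)) ((subSums (l.erase a)).image (a + ·)) := by
      intro hd
      rw [hSl, card_union_of_disjoint hd, card_image_of_injective _ (add_right_injective a),
        hS, card_image_nsmul_range hne] at hc
      omega
    obtain ⟨y, hy, hy'⟩ := not_disjoint_iff.1 hnd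
    obtain ⟨z, hz1, rfl⟩ := mem_image.1 hy'
    rw [hS] at hy hz1
    obtain ⟨i, hi, rfl⟩ := mem_image.1 hz1
    obtain ⟨j, hj, hij⟩ := mem_image.1 hy
    rw [mem_range] at hi hj
    have hij : j • g = a + i • g := hij
    have hlt : i < j := by
      by_contra hle
      obtain ⟨k, rfl⟩ := Nat.exists_eq_add_of_le (not_lt.1 hle)
      refine hz.add_ne_zero (hmem k (by omega)) ?_
      rw [add_nsmul, ← add_assoc, add_right_comm, eq_comm, add_eq_right] at hij
      exact hij
    obtain ⟨x, rfl⟩ := Nat.exists_eq_add_of_le hlt.le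
    have hax : a = x • g := by
      rw [add_nsmul, add_comm] at hij
      exact (add_right_cancel hij).symm
    refine ⟨g, x :: L, ?_, ?_, ?_, ?_⟩
    · refine hp.trans ?_
      rw [List.map_cons, hax]
      exact (hax ▸ hL).cons _
    · intro w hw
      rcases List.mem_cons.1 hw with rfl | hw
      · omega
      · exact hpos w hw
    · rw [hSl, hS, List.sum_cons]
      ext w
      simp only [mem_union, mem_image, mem_range]
      constructor
      · rintro (⟨k, hk, rfl⟩ | ⟨_, ⟨k, hk, rfl⟩, rfl⟩)
        · exact ⟨k, by omega, rfl⟩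
        · exact ⟨x + k, by omega, by rw [hax, add_nsmul]⟩
      · rintro ⟨k, hk, rfl⟩
        by_cases hks : k < L.sum + 1
        · exact Or.inl ⟨k, hks, rfl⟩
        · refine Or.inr ⟨_, ⟨k - x, by omega, rfl⟩, ?_⟩
          rw [hax, ← add_nsmul]
          congr 1
          omega
    · intro k hk hks
      rw [List.sum_cons] at hks
      by_cases hkL : k ≤ L.sum
      · exact hne k hk hkL
      · have := hz.add_ne_zero (hmem (k - x) (by omega))
        rwa [hax, ← add_nsmul, show x + (k - x) = k by omega] at this
  · push Not at hex
    have heq := fun a b => hl.eq_of_card_subSums_le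
      (fun a ha => by have := hex a ha; omega) (a := a) (b := b)
    obtain ⟨g, hg⟩ := List.exists_mem_of_length_pos (l := l) (by omega)
    have hrep : l = List.replicate (n + 1) g :=
      List.eq_replicate_iff.2 ⟨hn, fun b hb => heq b g hb hg⟩
    refine ⟨g, List.replicate (n + 1) 1, ?_, ?_, ?_, ?_⟩
    · rw [List.map_replicate, one_nsmul, ← hrep]
    · intro x hx
      rw [List.eq_of_mem_replicate hx]
      exact one_pos
    · rw [List.sum_replicate, smul_eq_mul, mul_one, hrep, subSums_replicate]
    · intro k hk hkn
      rw [List.sum_replicate, smul_eq_mul, mul_one] at hkn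
      have := hl (List.replicate k g)
        (by rw [hrep]; exact List.sublist_replicate_iff.2 ⟨k, hkn, rfl⟩)
        (by simp; omega)
      rwa [List.sum_replicate] at this

theorem three_mul_length_le_sum_add_count {L : List ℕ} (h : ∀ x ∈ L, 0 < x) :
    3 * L.length ≤ L.sum + 2 * L.count 1 + L.count 2 := by
  induction L with
  | nil => simp
  | cons a L ih =>
    have := ih fun x hx => h x (List.mem_cons_of_mem _ hx)
    have := h a List.mem_cons_self
    simp only [List.length_cons, List.sum_cons, List.count_cons, beq_iff_eq]
    split_ifs <;> omega

end ZeroSumFree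

/-- **Theorem.** If `α` is a zero-sum-free sequence of length `n` over an abelian group
with at most `m < 2n` subsequence sums, then some group element appears in `α` with
multiplicity at least `n − (m−1)/3`, i.e. the maximum multiplicity `μ` satisfies
`3μ ≥ 3n − (m − 1)` (stated in the subtraction-free form `3μ + m ≥ 3n + 1`). -/
theorem multiplicity_lower_bound {G : Type*} [AddCommGroup G] [DecidableEq G]
    (l : List G) (m : ℕ) (hzsf : ZeroSumFree l)
    (hm : (subSums l).card ≤ m) (hmn : m < 2 * l.length) :
    ∃ g : G, 3 * l.length + 1 ≤ 3 * l.count g + m := by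
  obtain ⟨g, L, hL, hpos, hS, hne⟩ := hzsf.exists_perm_map_nsmul (hm.trans_lt hmn)
  rw [hS, card_image_nsmul_range hne] at hm
  have hcount : ∀ k : ℕ, L.count k ≤ l.count (k • g) := fun k => by
    rw [hL.count_eq]
    exact List.count_le_count_map (f := (· • g))
  have hlen : l.length = L.length := by rw [hL.length_eq, List.length_map]
  have hbound := three_mul_length_le_sum_add_count hpos
  have h1 := hcount 1
  have h2 := hcount 2
  rcases le_total (l.count (1 • g)) (l.count (2 • g)) with h | h
  · exact ⟨2 • g, by omega⟩
  · exact ⟨1 • g, by omega⟩
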